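/- Let M ≥ 1 be an integer and τ > 0. For every y ∈ ℂ^M, the convolution of the channel-row density q_M with the complex Gaussian noise density φ_{τ²}^{(M)} satisfies ∫_{ℂ^M} q_M(y − w)·φ_{τ²}^{(M)}(w) dw = ∫₀^∞ (a·g^{−γ}·Q(g)/(π^M·(g²+τ²)^M))·exp(−‖y‖²/(g²+τ²)) dg. -/

import Mathlib

open MeasureTheory Set
open scoped ENNReal

noncomputable section

/-- `Q(g) = ∫_{b ln g + c}^∞ exp(-s²) ds`. -/
def Qfun (b c g : ℝ) : ℝ := ∫ s in Set.Ioi (b * Real.log g + c), Real.exp (-s ^ 2)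

/-- Squared Euclidean norm on `ℂ^M ≅ ℝ^{2M}`. -/
def nsq {M : ℕ} (r : Fin M → ℂ) : ℝ := ∑ i, ‖r i‖ ^ 2

/-- Circularly symmetric complex Gaussian density of variance `v` on `ℂ^M ≅ ℝ^{2M}`:
`φ_v^{(M)}(r) = (πv)^{-M} exp(-‖r‖²/v)`. -/
def vgauss (M : ℕ) (v : ℝ) (r : Fin M → ℂ) : ℝ :=
  ((Real.pi * v) ^ M)⁻¹ * Real.exp (-nsq r / v)

/-- Channel-row density `q_M(r) = a π^{-M} ∫₀^∞ g^{-γ-2M} Q(g) exp(-‖r‖²/g²) dg`. -/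
def qM (a γ b c : ℝ) (M : ℕ) (r : Fin M → ℂ) : ℝ :=
  a / Real.pi ^ M *
    ∫ g in Set.Ioi (0 : ℝ), g ^ (-γ - 2 * (M : ℝ)) * Qfun b c g * Real.exp (-nsq r / g ^ 2)

lemma integrable_exp_neg_sq : Integrable (fun s : ℝ => Real.exp (-s ^ 2)) := by
  simpa using integrable_exp_neg_mul_sq one_pos

lemma antitone_integral_Ioi_exp_neg_sq :
    Antitone (fun x : ℝ => ∫ s in Ioi x, Real.exp (-s ^ 2)) := fun _ _ hxy =>
  setIntegral_mono_set integrable_exp_neg_sq.integrableOn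
    (ae_of_all _ fun _ => (Real.exp_pos _).le) (Ioi_subset_Ioi hxy).eventuallyLE

lemma measurable_Qfun (b c : ℝ) : Measurable (Qfun b c) :=
  antitone_integral_Ioi_exp_neg_sq.measurable.comp
    ((Real.measurable_log.const_mul b).add_const c)

lemma Qfun_nonneg (b c g : ℝ) : 0 ≤ Qfun b c g :=
  integral_nonneg fun _ => (Real.exp_pos _).le

lemma Qfun_le_sqrt_pi (b c g : ℝ) : Qfun b c g ≤ √Real.pi := by
  have h := integral_gaussian 1
  simp only [neg_mul, one_mul, div_one] at h
  rw [← h]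
  exact setIntegral_le_integral integrable_exp_neg_sq (ae_of_all _ fun _ => (Real.exp_pos _).le)

lemma integral_Ioi_exp_neg_sq_le {k : ℝ} (hk : 0 < k) (x : ℝ) :
    ∫ s in Ioi x, Real.exp (-s ^ 2) ≤ Real.exp (k ^ 2 / 4) / k * Real.exp (-k * x) := by
  calc ∫ s in Ioi x, Real.exp (-s ^ 2)
      ≤ ∫ s in Ioi x, Real.exp (k ^ 2 / 4) * Real.exp (-k * s) := by
        refine setIntegral_mono integrable_exp_neg_sq.integrableOn
          ((integrableOn_exp_mul_Ioi (neg_neg_of_pos hk) x).const_mul _) fun s => ?_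
        simp only [← Real.exp_add]
        exact Real.exp_le_exp.2 (by nlinarith [sq_nonneg (s - k / 2)])
    _ = Real.exp (k ^ 2 / 4) / k * Real.exp (-k * x) := by
        rw [integral_const_mul, integral_exp_mul_Ioi (neg_neg_of_pos hk)]
        field_simp

/-- `Q` decays faster than any power at `0` when `b < 0`. -/
lemma Qfun_le_mul_rpow {b γ : ℝ} (hb : b < 0) (hγ : 0 < γ) (c : ℝ) :
    ∃ C, ∀ g, 0 < g → Qfun b c g ≤ C * g ^ γ := by
  have hk : 0 < γ / -b := div_pos hγ (neg_pos.2 hb)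
  refine ⟨Real.exp ((γ / -b) ^ 2 / 4) / (γ / -b) * Real.exp (-(γ / -b) * c), fun g hg => ?_⟩
  refine (integral_Ioi_exp_neg_sq_le hk (b * Real.log g + c)).trans_eq ?_
  rw [Real.rpow_def_of_pos hg, mul_assoc, ← Real.exp_add]
  congr 2
  field_simp [hb.ne]
  ring

lemma integrableOn_rpow_neg_mul_Qfun {b γ : ℝ} (hb : b < 0) (hγ : 1 < γ) (c : ℝ) :
    IntegrableOn (fun g => g ^ (-γ) * Qfun b c g) (Ioi 0) := by
  have hmeas : Measurable (fun g : ℝ => g ^ (-γ) * Qfun b c g) :=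
    (measurable_id.pow_const _).mul (measurable_Qfun b c)
  rw [← Ioc_union_Ioi_eq_Ioi zero_le_one]
  refine IntegrableOn.union ?_ ?_
  · obtain ⟨C, hC⟩ := Qfun_le_mul_rpow hb (zero_lt_one.trans hγ) c
    refine Measure.integrableOn_of_bounded (M := C) (by simp) hmeas.aestronglyMeasurable ?_
    filter_upwards [ae_restrict_mem measurableSet_Ioc] with g hg
    have hg0 : 0 < g ^ (-γ) := Real.rpow_pos_of_pos hg.1 _
    rw [Real.norm_of_nonneg (mul_nonneg hg0.le (Qfun_nonneg _ _ _))]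
    calc g ^ (-γ) * Qfun b c g ≤ g ^ (-γ) * (C * g ^ γ) := by gcongr; exact hC g hg.1
      _ = C := by rw [mul_left_comm, ← Real.rpow_add hg.1]; simp
  · refine Integrable.mono'
      ((integrableOn_Ioi_rpow_of_lt (neg_lt_neg hγ) one_pos).mul_const √Real.pi)
      hmeas.aestronglyMeasurable ?_
    filter_upwards [ae_restrict_mem measurableSet_Ioi] with g hg
    have hg0 : 0 < g ^ (-γ) := Real.rpow_pos_of_pos (one_pos.trans hg) _
    rw [Real.norm_of_nonneg (mul_nonneg hg0.le (Qfun_nonneg _ _ _))]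
    exact mul_le_mul_of_nonneg_left (Qfun_le_sqrt_pi _ _ _) hg0.le

lemma nsq_nonneg {M : ℕ} (r : Fin M → ℂ) : 0 ≤ nsq r :=
  Finset.sum_nonneg fun _ _ => sq_nonneg _

lemma measurable_nsq {M : ℕ} : Measurable (nsq : (Fin M → ℂ) → ℝ) := by
  unfold nsq
  fun_prop

lemma norm_sub_sq_div_add_norm_sq_div {s t : ℝ} (hs : 0 < s) (ht : 0 < t) (y w : ℂ) :
    ‖y - w‖ ^ 2 / s + ‖w‖ ^ 2 / t =
      (s + t) / (s * t) * ‖w - (t / (s + t) : ℝ) * y‖ ^ 2 + ‖y‖ ^ 2 / (s + t) := by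
  have hst : s + t ≠ 0 := (add_pos hs ht).ne'
  simp only [← Complex.normSq_eq_norm_sq, Complex.normSq_apply, Complex.sub_re, Complex.sub_im,
    Complex.re_ofReal_mul, Complex.im_ofReal_mul]
  field_simp
  ring

lemma exp_neg_norm_sub_sq_mul_exp_neg_norm_sq {s t : ℝ} (hs : 0 < s) (ht : 0 < t) (y w : ℂ) :
    Real.exp (-‖y - w‖ ^ 2 / s) * Real.exp (-‖w‖ ^ 2 / t) =
      Real.exp (-((s + t) / (s * t)) * ‖w - (t / (s + t) : ℝ) * y‖ ^ 2) *
        Real.exp (-‖y‖ ^ 2 / (s + t)) := by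
  rw [← Real.exp_add, ← Real.exp_add]
  congr 1
  linear_combination -norm_sub_sq_div_add_norm_sq_div hs ht y w

lemma integrable_gaussian_mul_gaussian {s t : ℝ} (hs : 0 < s) (ht : 0 < t) (y : ℂ) :
    Integrable (fun w : ℂ => Real.exp (-‖y - w‖ ^ 2 / s) * Real.exp (-‖w‖ ^ 2 / t)) := by
  simp only [exp_neg_norm_sub_sq_mul_exp_neg_norm_sq hs ht]
  have h : Integrable (fun v : ℂ => Real.exp (-((s + t) / (s * t)) * ‖v‖ ^ 2)) := by
    refine Integrable.of_integral_ne_zero ?_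
    rw [GaussianFourier.integral_rexp_neg_mul_sq_norm (by positivity)]
    positivity
  exact (h.comp_sub_right _).mul_const _

lemma integral_gaussian_mul_gaussian {s t : ℝ} (hs : 0 < s) (ht : 0 < t) (y : ℂ) :
    ∫ w : ℂ, Real.exp (-‖y - w‖ ^ 2 / s) * Real.exp (-‖w‖ ^ 2 / t) =
      Real.pi * s * t / (s + t) * Real.exp (-‖y‖ ^ 2 / (s + t)) := by
  simp only [exp_neg_norm_sub_sq_mul_exp_neg_norm_sq hs ht]
  rw [integral_mul_const,
    integral_sub_right_eq_self (fun v : ℂ => Real.exp (-((s + t) / (s * t)) * ‖v‖ ^ 2)),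
    GaussianFourier.integral_rexp_neg_mul_sq_norm (by positivity)]
  congr 1
  simp only [Complex.finrank_real_complex, Nat.cast_ofNat, div_self, ne_eq, OfNat.ofNat_ne_zero,
    not_false_eq_true, Real.rpow_one]
  field_simp

lemma exp_neg_nsq_div {M : ℕ} (r : Fin M → ℂ) (v : ℝ) :
    Real.exp (-nsq r / v) = ∏ i, Real.exp (-‖r i‖ ^ 2 / v) := by
  rw [← Real.exp_sum, nsq, ← Finset.sum_div, Finset.sum_neg_distrib]

lemma integrable_exp_neg_nsq_mul {M : ℕ} {s t : ℝ} (hs : 0 < s) (ht : 0 < t) (y : Fin M → ℂ) :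
    Integrable (fun w : Fin M → ℂ => Real.exp (-nsq (y - w) / s) * Real.exp (-nsq w / t)) := by
  simp only [exp_neg_nsq_div, ← Finset.prod_mul_distrib, Pi.sub_apply]
  exact Integrable.fintype_prod (f := fun i (w : ℂ) =>
    Real.exp (-‖y i - w‖ ^ 2 / s) * Real.exp (-‖w‖ ^ 2 / t))
    fun i => integrable_gaussian_mul_gaussian hs ht (y i)

lemma integral_exp_neg_nsq_mul {M : ℕ} {s t : ℝ} (hs : 0 < s) (ht : 0 < t) (y : Fin M → ℂ) :
    ∫ w : Fin M → ℂ, Real.exp (-nsq (y - w) / s) * Real.exp (-nsq w / t) =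
      (Real.pi * s * t / (s + t)) ^ M * Real.exp (-nsq y / (s + t)) := by
  simp only [exp_neg_nsq_div, ← Finset.prod_mul_distrib, Pi.sub_apply]
  rw [integral_fintype_prod_volume_eq_prod (fun i (w : ℂ) =>
    Real.exp (-‖y i - w‖ ^ 2 / s) * Real.exp (-‖w‖ ^ 2 / t))]
  simp only [integral_gaussian_mul_gaussian hs ht, Finset.prod_mul_distrib, Finset.prod_const,
    Finset.card_univ, Fintype.card_fin]

/-- The convolution integrand, up to constants, on `ℂ^M × (0, ∞)`. -/
def convIntegrand (γ b c : ℝ) {M : ℕ} (t : ℝ) (y w : Fin M → ℂ) (g : ℝ) : ℝ :=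
  g ^ (-γ - 2 * (M : ℝ)) * Qfun b c g * (Real.exp (-nsq (y - w) / g ^ 2) * Real.exp (-nsq w / t))

lemma convIntegrand_nonneg (γ b c : ℝ) {M : ℕ} (t : ℝ) (y w : Fin M → ℂ) {g : ℝ} (hg : 0 < g) :
    0 ≤ convIntegrand γ b c t y w g :=
  mul_nonneg (mul_nonneg (Real.rpow_nonneg hg.le _) (Qfun_nonneg _ _ _)) (by positivity)

lemma integral_convIntegrand (γ b c : ℝ) {M : ℕ} {t : ℝ} (ht : 0 < t) (y : Fin M → ℂ) {g : ℝ}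
    (hg : 0 < g) :
    ∫ w, convIntegrand γ b c t y w g =
      g ^ (-γ) * Qfun b c g *
        ((Real.pi * t / (g ^ 2 + t)) ^ M * Real.exp (-nsq y / (g ^ 2 + t))) := by
  have h : g ^ (-γ - 2 * (M : ℝ)) = g ^ (-γ) / (g ^ 2) ^ M := by
    rw [Real.rpow_sub hg, Real.rpow_mul hg.le, Real.rpow_natCast, Real.rpow_two]
  simp only [convIntegrand]
  rw [integral_const_mul, integral_exp_neg_nsq_mul (pow_pos hg 2) ht, h]
  simp only [div_pow, mul_pow]
  field_simp

lemma integrable_convIntegrand {γ b : ℝ} (hb : b < 0) (hγ : 1 < γ) (c : ℝ) {M : ℕ} {t : ℝ}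
    (ht : 0 < t) (y : Fin M → ℂ) :
    Integrable (fun p : (Fin M → ℂ) × ℝ => convIntegrand γ b c t y p.1 p.2)
      (volume.prod (volume.restrict (Ioi 0))) := by
  have hmeas : Measurable (fun p : (Fin M → ℂ) × ℝ => convIntegrand γ b c t y p.1 p.2) := by
    have h₁ := measurable_Qfun b c
    have h₂ := measurable_nsq (M := M)
    unfold convIntegrand
    fun_prop
  rw [integrable_prod_iff' hmeas.aestronglyMeasurable]
  constructor
  · filter_upwards [ae_restrict_mem measurableSet_Ioi] with g hg
    exact (integrable_exp_neg_nsq_mul (pow_pos hg 2) ht y).const_mul _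
  · have h : IntegrableOn (fun g => g ^ (-γ) * Qfun b c g *
        ((Real.pi * t / (g ^ 2 + t)) ^ M * Real.exp (-nsq y / (g ^ 2 + t)))) (Ioi 0) := by
      refine (integrableOn_rpow_neg_mul_Qfun hb hγ c).mul_bdd (c := Real.pi ^ M)
        (by fun_prop) (ae_of_all _ fun g => ?_)
      have hgt : 0 < g ^ 2 + t := by positivity
      rw [Real.norm_of_nonneg (by positivity)]
      refine (mul_le_of_le_one_right (by positivity) (Real.exp_le_one_iff.2 ?_)).trans ?_
      · exact div_nonpos_of_nonpos_of_nonneg (neg_nonpos.2 (nsq_nonneg y)) hgt.le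
      · gcongr
        rw [div_le_iff₀ hgt]
        nlinarith [Real.pi_pos, sq_nonneg g, mul_nonneg Real.pi_pos.le (sq_nonneg g)]
    refine h.congr_fun (fun g hg => ?_) measurableSet_Ioi
    simp only [Real.norm_of_nonneg (convIntegrand_nonneg γ b c t y _ hg)]
    exact (integral_convIntegrand γ b c ht y hg).symm

/-- convolution of the channel-row density `q_M` with the noise density
`φ_{τ²}^{(M)}`. -/
theorem stmt15
    (M : ℕ) (hM : 1 ≤ M)
    (R α β σ : ℝ) (hR : 0 < R) (hβ : 0 < β) (hσ : 0 < σ)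
    (γ a b c : ℝ)
    (hγ : γ = 40 / β + 1)
    (ha : a = 40 / (R ^ 2 * β * Real.sqrt Real.pi) *
      Real.exp (2 * (Real.log 10) ^ 2 * σ ^ 2 / β ^ 2 - 2 * (Real.log 10) * α / β))
    (hb : b = -10 * Real.sqrt 2 / ((Real.log 10) * σ))
    (hc : c = (-α - β * Real.logb 10 R) / (Real.sqrt 2 * σ) - 20 / (β * b))
    (τ : ℝ) (hτ : 0 < τ) (y : Fin M → ℂ) :
    ∫ w : Fin M → ℂ, qM a γ b c M (y - w) * vgauss M (τ ^ 2) w =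
      ∫ g in Set.Ioi (0 : ℝ),
        a * g ^ (-γ) * Qfun b c g / (Real.pi ^ M * (g ^ 2 + τ ^ 2) ^ M) *
          Real.exp (-nsq y / (g ^ 2 + τ ^ 2)) := by
  have hb0 : b < 0 := by
    have := Real.log_pos (show (1 : ℝ) < 10 by norm_num)
    rw [hb, neg_mul, neg_div, neg_lt_zero]
    positivity
  have hγ1 : 1 < γ := by
    rw [hγ]
    exact lt_add_of_pos_left 1 (by positivity)
  have ht : 0 < τ ^ 2 := pow_pos hτ 2
  have hL : ∀ w, qM a γ b c M (y - w) * vgauss M (τ ^ 2) w =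
      a / Real.pi ^ M * ((Real.pi * τ ^ 2) ^ M)⁻¹ *
        ∫ g in Ioi (0 : ℝ), convIntegrand γ b c (τ ^ 2) y w g := fun w => by
    simp only [qM, vgauss, convIntegrand, ← mul_assoc, integral_mul_const]
    ring
  simp only [hL]
  rw [integral_const_mul, integral_integral_swap (integrable_convIntegrand hb0 hγ1 c ht y),
    ← integral_const_mul]
  refine setIntegral_congr_fun measurableSet_Ioi fun g hg => ?_
  simp only [integral_convIntegrand γ b c ht y hg, div_pow, mul_pow]
  field_simp
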